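/- If there exists a real polynomial of degree 8 that defines the sign pattern (+,+,+,−,−,−,−,+,+), has no positive real roots, and has exactly six negative real roots, each simple, then there exists a monic real polynomial H of degree 8 that defines the sign pattern (+,+,+,−,−,−,−,+,+) and has the form H(x) = (x−ν_1)^2 (x−ν_2)^2 (x−ν_3)^2 (x−δ)^2 with ν_1 < ν_2 < ν_3 < 0 < δ (that is, H has three double negative roots and one double positive root and no other roots). -/

import Mathlib

open Polynomial

/-- A degree-8 real polynomial `P` defines the sign pattern `σ = (σ_0, …, σ_8)`
(with entries `1` for `+`, `-1` for `−`) if for each `j` the coefficient of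
`x^(8-j)` is nonzero and has sign `σ_j`. -/
def definesSignPattern (P : Polynomial ℝ) (σ : Fin 9 → ℝ) : Prop :=
  ∀ j : Fin 9, Real.sign (P.coeff (8 - (j : ℕ))) = σ j

theorem Polynomial.Splits.reverse {K : Type*} [Field K] {f : K[X]} (hf : f.Splits) :
    f.reverse.Splits := by
  induction hf using Submonoid.closure_induction with
  | mem p hp =>
    refine Splits.of_natDegree_le_one ((reverse_natDegree_le p).trans ?_)
    rcases hp with ⟨a, rfl⟩ | ⟨a, rfl⟩ <;> simp
  | one => exact Splits.of_natDegree_le_one ((reverse_natDegree_le 1).trans (by simp))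
  | mul p q _ _ hp hq => simpa only [reverse_mul_of_domain] using hp.mul hq

/-- The derivative of a real-rooted real polynomial is real-rooted. -/
theorem splits_derivative {f : ℝ[X]} (hf : f.Splits) : (derivative f).Splits := by
  rw [splits_iff_card_roots] at hf ⊢
  have h₁ := card_roots_le_derivative f
  have h₂ := card_roots' (derivative f)
  rw [natDegree_derivative] at h₂ ⊢
  omega

theorem splits_iterate_derivative {f : ℝ[X]} (hf : f.Splits) (k : ℕ) :
    (derivative^[k] f).Splits := by
  induction k with
  | zero => exact hf
  | succ k ih =>
    rw [Function.iterate_succ_apply']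
    exact splits_derivative ih

theorem natDegree_iterate_derivative_eq (f : ℝ[X]) (k : ℕ) :
    (derivative^[k] f).natDegree = f.natDegree - k := by
  induction k with
  | zero => rfl
  | succ k ih => rw [Function.iterate_succ_apply', natDegree_derivative, ih, Nat.sub_sub]

theorem discr_nonneg_of_splits {f : ℝ[X]} (hf : f.Splits) (hd : f.natDegree = 3) :
    0 ≤ (Cubic.mk (f.coeff 3) (f.coeff 2) (f.coeff 1) (f.coeff 0)).discr := by
  set P : Cubic ℝ := ⟨f.coeff 3, f.coeff 2, f.coeff 1, f.coeff 0⟩ with hP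
  have hfP : P.toPoly = f := by
    rw [f.as_sum_range_C_mul_X_pow, hd]
    simp only [Finset.sum_range_succ, Finset.sum_range_zero, Cubic.toPoly, hP]
    ring
  have ha : P.a ≠ 0 := by
    have : f.leadingCoeff ≠ 0 := leadingCoeff_ne_zero.mpr (by rintro rfl; simp at hd)
    rwa [leadingCoeff, hd] at this
  have hs : (P.toPoly.map (RingHom.id ℝ)).Splits := by rwa [Polynomial.map_id, hfP]
  obtain ⟨x, y, z, h⟩ := (Cubic.splits_iff_roots_eq_three ha).mp hs
  have := Cubic.discr_eq_prod_three_roots ha h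
  rw [RingHom.id_apply] at this
  rw [this]
  positivity

/-- For a real-rooted sextic, differentiating, reversing and differentiating again yields a
real-rooted cubic that involves only four consecutive coefficients. -/
theorem exists_cubic_of_sextic {f : ℝ[X]} (hf : f.Splits) (hd : f.natDegree = 6) {j : ℕ}
    (hj : j ≤ 3) (h0 : f.coeff j ≠ 0) :
    ∃ g : ℝ[X], g.Splits ∧ g.natDegree = 3 ∧ ∀ m ≤ 3, g.coeff m =
      (m + (3 - j)).descFactorial (3 - j) * ((3 - m + j).descFactorial j * f.coeff (3 - m + j)) := by
  have hd₁ : (derivative^[j] f).natDegree = 6 - j := by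
    rw [natDegree_iterate_derivative_eq, hd]
  have hc : (derivative^[j] f).coeff 0 ≠ 0 := by
    rw [coeff_iterate_derivative, zero_add, Nat.descFactorial_self, nsmul_eq_mul]
    exact mul_ne_zero (by exact_mod_cast j.factorial_ne_zero) h0
  have hd₂ : (derivative^[j] f).reverse.natDegree = 6 - j := by
    rw [reverse_natDegree, natTrailingDegree_eq_zero.mpr (Or.inr hc), hd₁, Nat.sub_zero]
  refine ⟨derivative^[3 - j] (derivative^[j] f).reverse,
    splits_iterate_derivative (splits_iterate_derivative hf j).reverse _, ?_, fun m hm => ?_⟩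
  · rw [natDegree_iterate_derivative_eq, hd₂]
    omega
  · rw [coeff_iterate_derivative, coeff_reverse, hd₁, revAt_le (by omega),
      show 6 - j - (m + (3 - j)) = 3 - m by omega, coeff_iterate_derivative, nsmul_eq_mul,
      nsmul_eq_mul]

/-- Up to a constant, the discriminant of the cubic `b₀ X³ + 3 b₁ X² + 3 b₂ X + b₃`. -/
def normalizedDiscr (b₀ b₁ b₂ b₃ : ℝ) : ℝ :=
  4 * (b₁ ^ 2 - b₀ * b₂) * (b₂ ^ 2 - b₁ * b₃) - (b₁ * b₂ - b₀ * b₃) ^ 2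

theorem normalizedDiscr_high_nonneg {f : ℝ[X]} (hf : f.Splits) (hd : f.natDegree = 6)
    (h0 : f.coeff 2 ≠ 0) :
    0 ≤ normalizedDiscr (f.coeff 5 / 6) (f.coeff 4 / 15) (f.coeff 3 / 20) (f.coeff 2 / 15) := by
  obtain ⟨g, hg, hgd, hc⟩ := exists_cubic_of_sextic hf hd (j := 2) (by norm_num) h0
  have := discr_nonneg_of_splits hg hgd
  rw [hc 0 (by norm_num), hc 1 (by norm_num), hc 2 (by norm_num), hc 3 (by norm_num)] at this
  norm_num [Cubic.discr, Nat.descFactorial] at this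
  rw [normalizedDiscr]
  linarith

theorem normalizedDiscr_low_nonneg {f : ℝ[X]} (hf : f.Splits) (hd : f.natDegree = 6)
    (h0 : f.coeff 0 ≠ 0) :
    0 ≤ normalizedDiscr (f.coeff 3 / 20) (f.coeff 2 / 15) (f.coeff 1 / 6) (f.coeff 0) := by
  obtain ⟨g, hg, hgd, hc⟩ := exists_cubic_of_sextic hf hd (j := 0) (by norm_num) h0
  have := discr_nonneg_of_splits hg hgd
  rw [hc 0 (by norm_num), hc 1 (by norm_num), hc 2 (by norm_num), hc 3 (by norm_num)] at this
  norm_num [Cubic.discr, Nat.descFactorial] at this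
  rw [normalizedDiscr]
  linarith

theorem mul_le_sq_of_normalizedDiscr_nonneg {w x y z : ℝ} (hx : 0 < x) (hy : 0 < y)
    (h : 0 ≤ normalizedDiscr w x y z) : w * y ≤ x ^ 2 ∧ x * z ≤ y ^ 2 := by
  rw [normalizedDiscr] at h
  by_contra hcon
  obtain ⟨s, hs⟩ : ∃ s, s = w * y - x ^ 2 := ⟨_, rfl⟩
  obtain ⟨t, ht⟩ : ∃ t, t = x * z - y ^ 2 := ⟨_, rfl⟩
  have hst : (x * y - w * z) ^ 2 ≤ 4 * s * t := by rw [hs, ht]; linarith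
  have hpos : 0 ≤ s ∧ 0 ≤ t ∧ 0 < s + t := by
    have hst₀ : 0 ≤ s * t := by nlinarith [sq_nonneg (x * y - w * z)]
    rw [not_and_or, not_le, not_le] at hcon
    rcases hcon with hcon | hcon
    · have hs' : 0 < s := by linarith
      have ht' := nonneg_of_mul_nonneg_right hst₀ hs'
      exact ⟨hs'.le, ht', by linarith⟩
    · have ht' : 0 < t := by linarith
      have hs' := nonneg_of_mul_nonneg_left hst₀ ht'
      exact ⟨hs', ht'.le, by linarith⟩
  obtain ⟨hs₀, ht₀, hst₀⟩ := hpos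
  have hid : (w * z - x * y) * (x * y) = x ^ 2 * t + y ^ 2 * s + s * t := by rw [hs, ht]; ring
  have h₁ : (x ^ 2 * t + y ^ 2 * s + s * t) ^ 2 ≤ 4 * s * t * (x * y) ^ 2 := by
    rw [← hid, mul_pow, ← neg_sub, neg_sq]
    gcongr
  have hU : 0 < x ^ 2 * t + y ^ 2 * s := by
    rcases hs₀.eq_or_lt with h₀ | h₀
    · have : 0 < t := by linarith
      positivity
    · positivity
  have hU₂ : 4 * s * t * (x * y) ^ 2 ≤ (x ^ 2 * t + y ^ 2 * s) ^ 2 := by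
    nlinarith [sq_nonneg (x ^ 2 * t - y ^ 2 * s)]
  rcases (mul_nonneg hs₀ ht₀).eq_or_lt with h₀ | h₀
  · rw [mul_assoc 4 s t, ← h₀] at h₁
    nlinarith
  · nlinarith [mul_pos hU h₀]

/-- Values of the Hessian of a real-rooted cubic are nonnegative. -/
theorem hessian_nonneg {w x y z : ℝ} (hx : 0 < x) (hy : 0 < y)
    (h : 0 ≤ normalizedDiscr w x y z) (m : ℝ) :
    0 ≤ (x ^ 2 - w * y) * m ^ 2 - (x * y - w * z) * m + (y ^ 2 - x * z) := by
  obtain ⟨h₁, h₂⟩ := mul_le_sq_of_normalizedDiscr_nonneg hx hy h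
  rw [normalizedDiscr] at h
  rcases h₁.eq_or_lt with h₁ | h₁
  · have : x * y - w * z = 0 := by
      rw [h₁] at h
      nlinarith
    rw [h₁, this]
    linarith
  · have : 0 < x ^ 2 - w * y := by linarith
    refine nonneg_of_mul_nonneg_right ?_ this
    nlinarith [sq_nonneg (2 * (x ^ 2 - w * y) * m - (x * y - w * z))]

/-- Here `w, x, y, z` are consecutive normalized coefficients of a real-rooted sextic, and `hc` is
concavity of the unnormalized sequence at `15 x`. -/
theorem lt_of_high_concave {w x y z : ℝ} (hw : 0 < w) (hx : 0 < x) (hy : 0 < y)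
    (h : 0 ≤ normalizedDiscr w x y z) (hc : 20 * y - 30 * x + 6 * w < 0) :
    3 * z < 4 * y := by
  have h₁ := hessian_nonneg hx hy h 1
  obtain ⟨-, h₂⟩ := mul_le_sq_of_normalizedDiscr_nonneg hx hy h
  by_contra! hcon
  have hxy : x ≤ 3 / 4 * y := by
    have : x * (4 * y) ≤ 3 * y ^ 2 := by nlinarith
    nlinarith
  have hz' : (x - w) * (4 * y) ≤ (x - w) * (3 * z) := by
    apply mul_le_mul_of_nonneg_left hcon
    linarith
  have hw' : w * y ≤ (5 * x - 10 / 3 * y) * y := by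
    apply mul_le_mul_of_nonneg_right _ hy.le
    linarith
  nlinarith [mul_nonneg (sub_nonneg.mpr hxy) hx.le, mul_nonneg (sub_nonneg.mpr hxy) hy.le,
    mul_pos hy hy]

/-- Here `v, w, x, y` are consecutive normalized coefficients of a real-rooted sextic, and `hc` is
concavity of the unnormalized sequence at `6 x`. -/
theorem lt_of_low_concave {v w x y : ℝ} (hv : 0 < v) (hw : 0 < w) (hx : 0 < x) (hy : 0 < y)
    (h : 0 ≤ normalizedDiscr v w x y) (hc : y - 12 * x + 15 * w < 0) :
    4 * v < 3 * w := by
  have h₁ := hessian_nonneg hw hx h 2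
  obtain ⟨h₂, -⟩ := mul_le_sq_of_normalizedDiscr_nonneg hw hx h
  by_contra! hcon
  have hxw : x ≤ 4 / 3 * w := by
    have : 3 * w * x ≤ 4 * w ^ 2 := by nlinarith
    nlinarith
  have hv' : (4 * x - 2 * y) * (3 * w) ≤ (4 * x - 2 * y) * (4 * v) := by
    apply mul_le_mul_of_nonneg_left hcon
    linarith
  have hy' : y * w ≤ (12 * x - 15 * w) * w := by
    apply mul_le_mul_of_nonneg_right _ hw.le
    linarith
  nlinarith [mul_nonneg (sub_nonneg.mpr hxw) hx.le, mul_nonneg (sub_nonneg.mpr hxw) hw.le,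
    mul_pos hw hw]

/-- Multiplying a real-rooted sextic with positive coefficients by `(X - δ) ^ 2`, where `δ > 0`,
cannot make the coefficients of `X ^ 5` and `X ^ 2` both negative. -/
theorem not_concave_of_splits {f : ℝ[X]} (hf : f.Splits) (hd : f.natDegree = 6)
    (hpos : ∀ k ≤ 6, 0 < f.coeff k) {δ : ℝ} (hδ : 0 < δ)
    (h₅ : f.coeff 3 - 2 * δ * f.coeff 4 + δ ^ 2 * f.coeff 5 < 0)
    (h₂ : f.coeff 0 - 2 * δ * f.coeff 1 + δ ^ 2 * f.coeff 2 < 0) : False := by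
  have p₀ := hpos 0 (by norm_num)
  have p₁ := hpos 1 (by norm_num)
  have p₂ := hpos 2 (by norm_num)
  have p₃ := hpos 3 (by norm_num)
  have p₄ := hpos 4 (by norm_num)
  have p₅ := hpos 5 (by norm_num)
  have hA := normalizedDiscr_high_nonneg hf hd p₂.ne'
  have hB := normalizedDiscr_low_nonneg hf hd p₀.ne'
  have scale (w x y z : ℝ) : normalizedDiscr (δ ^ 3 * w) (δ ^ 2 * x) (δ * y) z =
      δ ^ 6 * normalizedDiscr w x y z := by simp only [normalizedDiscr]; ring
  have h₃ := lt_of_high_concave (by positivity) (by positivity) (by positivity)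
    ((mul_nonneg (by positivity) hA).trans_eq (scale _ _ _ _).symm)
    (by nlinarith [mul_pos_of_neg_of_neg (neg_neg_of_pos hδ) h₅])
  have h₄ := lt_of_low_concave (by positivity) (by positivity) (by positivity) (by positivity)
    ((mul_nonneg (by positivity) hB).trans_eq (scale _ _ _ _).symm) (by linarith)
  nlinarith

theorem coeff_prod_X_sub_C_pos {ι : Type*} (s : Finset ι) (z : ι → ℝ) (hz : ∀ i, z i < 0) :
    ∀ k ≤ s.card, 0 < (∏ i ∈ s, (X - C (z i))).coeff k := by
  classical
  induction s using Finset.induction_on with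
  | empty => simp
  | insert a s ha ih =>
    have hd : (∏ i ∈ s, (X - C (z i))).natDegree = s.card := natDegree_finsetProd_X_sub_C_eq_card ..
    have hnn (k : ℕ) : 0 ≤ (∏ i ∈ s, (X - C (z i))).coeff k := by
      rcases le_or_gt k s.card with hk | hk
      · exact (ih k hk).le
      · rw [coeff_eq_zero_of_natDegree_lt (hd ▸ hk)]
    intro k hk
    rw [Finset.card_insert_of_notMem ha] at hk
    rw [Finset.prod_insert ha, sub_mul, coeff_sub, coeff_C_mul]
    rcases k with _ | k
    · have := mul_neg_of_neg_of_pos (hz a) (ih 0 (Nat.zero_le _))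
      simpa using this
    · rw [coeff_X_mul]
      have := mul_nonpos_of_nonpos_of_nonneg (hz a).le (hnn (k + 1))
      linarith [ih k (by omega)]

theorem Real.sign_eq_one_iff_pos {x : ℝ} : Real.sign x = 1 ↔ 0 < x := by
  rcases lt_trichotomy x 0 with h | rfl | h
  · rw [Real.sign_of_neg h]
    norm_num [h.le]
  · simp
  · simp [Real.sign_of_pos h, h]

theorem Real.sign_eq_neg_one_iff_neg {x : ℝ} : Real.sign x = -1 ↔ x < 0 := by
  rw [← neg_pos, ← Real.sign_eq_one_iff_pos, Real.sign_neg, neg_eq_iff_eq_neg]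

/-- The sign pattern `(+,+,+,−,−,−,−,+,+)` is not realizable with no positive and six distinct
negative roots. -/
theorem not_realizable {P : ℝ[X]} (hP : P.degree = 8)
    (hσ : definesSignPattern P ![1, 1, 1, -1, -1, -1, -1, 1, 1])
    (hroot : ∀ x : ℝ, 0 < x → P.eval x ≠ 0) {z : Fin 6 → ℝ} (hz : Function.Injective z)
    (hneg : ∀ i, z i < 0) (hPz : ∀ i, P.eval (z i) = 0) : False := by
  have hP₀ : P ≠ 0 := by rintro rfl; simp at hP
  obtain ⟨S, hS⟩ : ∏ i, (X - C (z i)) ∣ P :=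
    Finset.prod_dvd_of_coprime ((pairwise_coprime_X_sub_C hz).set_pairwise _)
      fun i _ => dvd_iff_isRoot.mpr (hPz i)
  set R : ℝ[X] := ∏ i, (X - C (z i)) with hR
  have hRsplits : R.Splits := Splits.prod fun i _ => Splits.X_sub_C _
  have hRdeg : R.natDegree = 6 := natDegree_finsetProd_X_sub_C_eq_card ..
  have hRpos : ∀ k ≤ 6, 0 < R.coeff k := coeff_prod_X_sub_C_pos Finset.univ z hneg
  have hRS : R ≠ 0 ∧ S ≠ 0 := mul_ne_zero_iff.mp (hS ▸ hP₀)
  have hSdeg : S.natDegree = 2 := by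
    have := natDegree_eq_of_degree_eq_some (n := 8) hP
    rw [hS, natDegree_mul hRS.1 hRS.2, hRdeg] at this
    omega
  have hSexp : S = C (S.coeff 2) * X ^ 2 + C (S.coeff 1) * X + C (S.coeff 0) := by
    conv_lhs => rw [S.as_sum_range_C_mul_X_pow, hSdeg]
    simp only [Finset.sum_range_succ, Finset.sum_range_zero]
    ring
  set a := S.coeff 2
  set b := S.coeff 1
  set c := S.coeff 0
  have hPexp : P = C a * (R * X ^ 2) + C b * (R * X) + C c * R := by rw [hS, hSexp]; ring
  have hPeval (x : ℝ) : P.eval x = R.eval x * (a * x ^ 2 + b * x + c) := by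
    rw [hS, hSexp]
    simp
  have q₈ : 0 < P.coeff 8 := Real.sign_eq_one_iff_pos.mp (hσ 0)
  have q₅ : P.coeff 5 < 0 := Real.sign_eq_neg_one_iff_neg.mp (hσ 3)
  have q₂ : P.coeff 2 < 0 := Real.sign_eq_neg_one_iff_neg.mp (hσ 6)
  have q₀ : 0 < P.coeff 0 := Real.sign_eq_one_iff_pos.mp (hσ 8)
  have hR₇ : R.coeff 7 = 0 := coeff_eq_zero_of_natDegree_lt (by omega)
  have hR₈ : R.coeff 8 = 0 := coeff_eq_zero_of_natDegree_lt (by omega)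
  rw [hPexp] at q₈ q₅ q₂ q₀
  simp [coeff_mul_X_pow', coeff_mul_X, hR₇, hR₈, -map_mul] at q₈ q₅ q₂ q₀
  have ha : 0 < a := pos_of_mul_pos_left q₈ (hRpos 6 le_rfl).le
  have hc : 0 < c := pos_of_mul_pos_left q₀ (hRpos 0 (by norm_num)).le
  have r₃ := hRpos 3 (by norm_num)
  have r₄ := hRpos 4 (by norm_num)
  have r₅ := hRpos 5 (by norm_num)
  have r₂ := hRpos 2 (by norm_num)
  have hb : b < 0 := by
    by_contra! hb
    have : 0 ≤ a * R.coeff 3 + b * R.coeff 4 + c * R.coeff 5 := by positivity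
    linarith
  have hdisc : b ^ 2 < 4 * a * c := by
    by_contra! h
    have hsq := Real.sq_sqrt (sub_nonneg.mpr h)
    have hnn := Real.sqrt_nonneg (b ^ 2 - 4 * a * c)
    generalize √(b ^ 2 - 4 * a * c) = r at hsq hnn
    refine hroot ((-b + r) / (2 * a)) (div_pos (by linarith) (by positivity)) ?_
    rw [hPeval]
    refine mul_eq_zero_of_right _ ?_
    field_simp
    linear_combination hsq
  obtain ⟨δ, hδ⟩ : ∃ δ, δ = -b / (2 * a) := ⟨_, rfl⟩
  have hbδ : b = -(2 * a * δ) := by rw [hδ]; field_simp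
  have hδpos : 0 < δ := hδ ▸ div_pos (neg_pos.mpr hb) (by positivity)
  have hcδ : a * δ ^ 2 ≤ c := by
    rw [hbδ] at hdisc
    nlinarith
  refine not_concave_of_splits hRsplits hRdeg hRpos hδpos ?_ ?_
  · rw [hbδ] at q₅
    refine neg_of_mul_neg_right ?_ ha.le
    linarith [mul_le_mul_of_nonneg_right hcδ r₅.le]
  · rw [hbδ] at q₂
    refine neg_of_mul_neg_right ?_ ha.le
    linarith [mul_le_mul_of_nonneg_right hcδ r₂.le]

/-- If the sign pattern (+,+,+,−,−,−,−,+,+) is realizable with the pair (0,6),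
then there is a monic degree 8 polynomial with that sign pattern having three
double negative roots and one double positive root (and no other roots). -/
theorem stmt7
    (h : ∃ P : Polynomial ℝ, P.degree = 8 ∧
      definesSignPattern P ![1, 1, 1, -1, -1, -1, -1, 1, 1] ∧
      (∀ x : ℝ, 0 < x → P.eval x ≠ 0) ∧
      ∃ z : Fin 6 → ℝ, StrictMono z ∧ (∀ i, z i < 0) ∧
        (∀ i, P.eval (z i) = 0) ∧ (∀ i, P.rootMultiplicity (z i) = 1) ∧
        (∀ x : ℝ, x < 0 → P.eval x = 0 → ∃ i, x = z i)) :
    ∃ ν₁ ν₂ ν₃ δ : ℝ, ν₁ < ν₂ ∧ ν₂ < ν₃ ∧ ν₃ < 0 ∧ 0 < δ ∧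
      definesSignPattern
        ((X - C ν₁) ^ 2 * (X - C ν₂) ^ 2 * (X - C ν₃) ^ 2 * (X - C δ) ^ 2)
        ![1, 1, 1, -1, -1, -1, -1, 1, 1] := by
  obtain ⟨P, hP, hσ, hroot, z, hz, hneg, hPz, -⟩ := h
  exact (not_realizable hP hσ hroot hz.injective hneg hPz).elim
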